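/- arXiv:2103.03046 — 7 statements merged into one kernel-verified Lean document; each statement's English description precedes it below -/
import Mathlib

section
/- Let P be a type, L a finite nonempty set of labels, f : Finset P → L a classifier, T a finite subset of P with |T| = n, and k a positive integer. Let r be a nonnegative integer with k ≤ n − r. Suppose p_y′ and p_e′ are real numbers that are integer multiples of 1/C(n,k) such that p_y′ ≤ Pr(f(S_k(T)) = y) and Pr(f(S_k(T)) = i) ≤ p_e′ for every label i ≠ y, where y ∈ L. If for every integer t with n − r ≤ t ≤ n + r it holds that C(t,k)/C(n,k) − 2·C(max(n,t) − r, k)/C(n,k) + 1 − p_y′ + p_e′ < 0, then for every finite subset T* of P with perturbation size η(T,T*) = max(|T|,|T*|) − |T ∩ T*| ≤ r and every label i ≠ y we have Pr(f(S_k(T*)) = y) > Pr(f(S_k(T*)) = i). -/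
open Finset

open Classical in
/-- The label probability `Pr(f(S_k(T)) = i)`: the probability that classifier `f`
assigns label `i` to a uniformly random `k`-element subset of `T`. -/
noncomputable def labelProb {P L : Type*} (f : Finset P → L) (T : Finset P) (k : ℕ)
    (i : L) : ℝ :=
  (((T.powersetCard k).filter fun S => f S = i).card : ℝ) / (T.card.choose k : ℝ)

theorem aux_mono {P : Type*} (p : Finset P → Prop) [DecidablePred p]
    (U T : Finset P) (h : U ⊆ T) (k : ℕ) :
    ((U.powersetCard k).filter p).card ≤ ((T.powersetCard k).filter p).card :=
  card_le_card (filter_subset_filter _ (powersetCard_mono h))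

theorem aux_diff {P : Type*} (p : Finset P → Prop) [DecidablePred p]
    (U T : Finset P) (h : U ⊆ T) (k : ℕ) :
    ((T.powersetCard k).filter p).card + U.card.choose k
      ≤ ((U.powersetCard k).filter p).card + T.card.choose k := by
  have h1 := aux_mono (fun S => ¬ p S) U T h k
  have h2 := card_filter_add_card_filter_not (s := U.powersetCard k) p
  have h3 := card_filter_add_card_filter_not (s := T.powersetCard k) p
  rw [card_powersetCard] at h2 h3
  omega

theorem certified_perturbation_size
    {P L : Type*} [Fintype L] [Nonempty L] [DecidableEq P]
    (f : Finset P → L) (T : Finset P) (n k r : ℕ)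
    (hT : T.card = n) (hk : 0 < k) (hkr : k ≤ n - r)
    (y : L) (py' pe' : ℝ)
    (hpy_mult : ∃ a : ℤ, py' = (a : ℝ) / (n.choose k : ℝ))
    (hpe_mult : ∃ a : ℤ, pe' = (a : ℝ) / (n.choose k : ℝ))
    (hpy : py' ≤ labelProb f T k y)
    (hpe : ∀ i : L, i ≠ y → labelProb f T k i ≤ pe')
    (hcond : ∀ t : ℕ, n - r ≤ t → t ≤ n + r →
      (t.choose k : ℝ) / (n.choose k : ℝ)
        - 2 * (((max n t - r).choose k : ℝ) / (n.choose k : ℝ))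
        + 1 - py' + pe' < 0) :
    ∀ Ts : Finset P, max T.card Ts.card - (T ∩ Ts).card ≤ r →
      ∀ i : L, i ≠ y → labelProb f Ts k i < labelProb f Ts k y := by
  classical
  intro Ts hη i hi
  have hm1 : (T ∩ Ts).card ≤ T.card := card_le_card inter_subset_left
  have hm2 : (T ∩ Ts).card ≤ Ts.card := card_le_card inter_subset_right
  have hle : max n Ts.card - r ≤ (T ∩ Ts).card := by omega
  have hc := hcond Ts.card (by omega) (by omega)
  have hch : (((max n Ts.card - r).choose k : ℕ) : ℝ) ≤ ((T ∩ Ts).card.choose k : ℕ) :=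
    Nat.cast_le.mpr (Nat.choose_le_choose k hle)
  have hN : (0 : ℝ) < (n.choose k : ℝ) := Nat.cast_pos.mpr (Nat.choose_pos (by omega))
  have hM : (0 : ℝ) < (Ts.card.choose k : ℝ) := Nat.cast_pos.mpr (Nat.choose_pos (by omega))
  have hpi := hpe i hi
  unfold labelProb at hpy hpi ⊢
  rw [hT] at hpy hpi
  refine div_lt_div_of_pos_right ?_ hM
  have a1 := aux_mono (fun S => f S = y) (T ∩ Ts) Ts inter_subset_right k
  have a2 := aux_diff (fun S => f S = y) (T ∩ Ts) T inter_subset_left k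
  have a3 := aux_mono (fun S => f S = i) (T ∩ Ts) T inter_subset_left k
  have a4 := aux_diff (fun S => f S = i) (T ∩ Ts) Ts inter_subset_right k
  rw [hT] at a2
  rw [le_div_iff₀ hN] at hpy
  rw [div_le_iff₀ hN] at hpi
  have hc' := mul_neg_of_neg_of_pos hc hN
  have e : ((Ts.card.choose k : ℝ) / (n.choose k : ℝ)
        - 2 * (((max n Ts.card - r).choose k : ℝ) / (n.choose k : ℝ))
        + 1 - py' + pe') * (n.choose k : ℝ) = (Ts.card.choose k : ℝ)
        - 2 * ((max n Ts.card - r).choose k : ℝ) + (n.choose k : ℝ)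
        - py' * (n.choose k : ℝ) + pe' * (n.choose k : ℝ) := by
    field_simp
  rw [e] at hc'
  rify at a1 a2 a3 a4
  convert_to ((#{S ∈ powersetCard k Ts | f S = i} : ℕ) : ℝ) < ((#{S ∈ powersetCard k Ts | f S = y} : ℕ) : ℝ)
  have b1 : ((#{S ∈ powersetCard k T | f S = i} : ℕ) : ℝ) ≤ pe' * (n.choose k : ℝ) := by
    convert hpi
  have b2 : py' * (n.choose k : ℝ) ≤ ((#{S ∈ powersetCard k T | f S = y} : ℕ) : ℝ) := by
    convert hpy
  linarith
end

section
/- Let P be a type, L a finite nonempty set of labels, f : Finset P → L a classifier, T a finite subset of P with |T| = n, k a positive integer, and r a nonnegative integer with k ≤ n − r. Suppose p_y′ and p_e′ are real numbers that are integer multiples of 1/C(n,k) such that p_y′ ≤ Pr(f(S_k(T)) = y) and Pr(f(S_k(T)) = i) ≤ p_e′ for every label i ≠ y, where y ∈ L. If 1 − C(n−r, k)/C(n,k) − (p_y′ − p_e′)/2 < 0, then for every finite subset T* of P with |T*| = n and |T ∩ T*| ≥ n − r (i.e., T* is obtained from T by modifying at most r points) and every label i ≠ y we have Pr(f(S_k(T*))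 = y) > Pr(f(S_k(T*)) = i). -/
open Finset

open Classical in
theorem labelProb_le_add {P L : Type*} [DecidableEq P] (f : Finset P → L) (A B : Finset P) (n k r : ℕ)
    (hA : A.card = n) (hB : B.card = n) (hkr : k ≤ n - r)
    (hAB : n - r ≤ (A ∩ B).card) (i : L) :
    labelProb f A k i ≤ labelProb f B k i
      + (1 - ((n - r).choose k : ℝ) / (n.choose k : ℝ)) := by
  have hD : (0 : ℝ) < (n.choose k : ℝ) := by
    exact_mod_cast Nat.choose_pos (by omega)
  have hsub : (A.powersetCard k).filter (fun S => f S = i) ⊆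
      (B.powersetCard k).filter (fun S => f S = i) ∪
        (A.powersetCard k \ (A ∩ B).powersetCard k) := by
    intro S hS
    simp only [mem_filter, mem_powersetCard, mem_union, mem_sdiff, subset_inter_iff] at hS ⊢
    tauto
  have h1 := (card_le_card hsub).trans (card_union_le _ _)
  have h2 : (A.powersetCard k \ (A ∩ B).powersetCard k).card
      + ((A ∩ B).powersetCard k).card = (A.powersetCard k).card :=
    card_sdiff_add_card_eq_card (powersetCard_mono inter_subset_left)
  rw [card_powersetCard, card_powersetCard, hA] at h2
  have h3 : (n - r).choose k ≤ (A ∩ B).card.choose k := Nat.choose_le_choose k hAB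
  have h4 : ((A.powersetCard k).filter (fun S => f S = i)).card + (n - r).choose k ≤
      ((B.powersetCard k).filter (fun S => f S = i)).card + n.choose k := by omega
  have h5 : (((A.powersetCard k).filter (fun S => f S = i)).card : ℝ) + ((n - r).choose k : ℝ) ≤
      (((B.powersetCard k).filter (fun S => f S = i)).card : ℝ) + (n.choose k : ℝ) := by
    exact_mod_cast h4
  have h6 := div_le_div_of_nonneg_right h5 hD.le
  rw [add_div, add_div, div_self hD.ne'] at h6
  unfold labelProb
  rw [hA, hB]
  linarith

theorem certified_robustness_point_modification
    {P L : Type*} [Fintype L] [Nonempty L] [DecidableEq P]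
    (f : Finset P → L) (T : Finset P) (n k r : ℕ)
    (hT : T.card = n) (hk : 0 < k) (hkr : k ≤ n - r)
    (y : L) (py' pe' : ℝ)
    (hpy_mult : ∃ a : ℤ, py' = (a : ℝ) / (n.choose k : ℝ))
    (hpe_mult : ∃ a : ℤ, pe' = (a : ℝ) / (n.choose k : ℝ))
    (hpy : py' ≤ labelProb f T k y)
    (hpe : ∀ i : L, i ≠ y → labelProb f T k i ≤ pe')
    (hcond : 1 - ((n - r).choose k : ℝ) / (n.choose k : ℝ) - (py' - pe') / 2 < 0) :
    ∀ Ts : Finset P, Ts.card = n → n - r ≤ (T ∩ Ts).card →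
      ∀ i : L, i ≠ y → labelProb f Ts k i < labelProb f Ts k y := by
  intro Ts hTs hint i hi
  have hy := labelProb_le_add f T Ts n k r hT hTs hkr hint y
  have hI := labelProb_le_add f Ts T n k r hTs hT hkr
    (by rw [inter_comm]; exact hint) i
  have := hpe i hi
  linarith
end

section
/- Let P be a type, L a finite nonempty set of labels, f : Finset P → L a classifier, T a finite subset of P with |T| = n, k a positive integer with k ≤ n, and r a nonnegative integer. Suppose p_y′ and p_e′ are real numbers that are integer multiples of 1/C(n,k) such that p_y′ ≤ Pr(f(S_k(T)) = y) and Pr(f(S_k(T)) = i) ≤ p_e′ for every label i ≠ y, where y ∈ L. If C(n+r, k)/C(n,k) − 1 − p_y′ + p_e′ < 0, then for every finite subset T* of P with T ⊆ T* and |T*| ≤ n + r (i.e., T* is obtained from T by adding at most r new points) and every label i ≠ y we have Pr(f(S_k(T*)) = y) > Pr(f(S_k(T*)) = i). -/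
open Finset

theorem certified_robustness_point_addition
    {P L : Type*} [Fintype L] [Nonempty L] [DecidableEq P]
    (f : Finset P → L) (T : Finset P) (n k r : ℕ)
    (hT : T.card = n) (hk : 0 < k) (hkn : k ≤ n)
    (y : L) (py' pe' : ℝ)
    (hpy_mult : ∃ a : ℤ, py' = (a : ℝ) / (n.choose k : ℝ))
    (hpe_mult : ∃ a : ℤ, pe' = (a : ℝ) / (n.choose k : ℝ))
    (hpy : py' ≤ labelProb f T k y)
    (hpe : ∀ i : L, i ≠ y → labelProb f T k i ≤ pe')
    (hcond : ((n + r).choose k : ℝ) / (n.choose k : ℝ) - 1 - py' + pe' < 0) :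
    ∀ Ts : Finset P, T ⊆ Ts → Ts.card ≤ n + r →
      ∀ i : L, i ≠ y → labelProb f Ts k i < labelProb f Ts k y := by
  classical
  intro Ts hTs hcard i hi
  have h1 := hpe i hi
  unfold labelProb at *
  rw [hT] at hpy h1
  have hc : (0 : ℝ) < (n.choose k : ℝ) := by exact_mod_cast Nat.choose_pos hkn
  have hle : n ≤ Ts.card := hT ▸ card_le_card hTs
  have hc' : (0 : ℝ) < (Ts.card.choose k : ℝ) := by
    exact_mod_cast Nat.choose_pos (hkn.trans hle)
  have hps : T.powersetCard k ⊆ Ts.powersetCard k := powersetCard_mono hTs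
  have hy : ((T.powersetCard k).filter fun S => f S = y).card ≤
      ((Ts.powersetCard k).filter fun S => f S = y).card :=
    card_le_card (filter_subset_filter _ hps)
  have hi1 : ((Ts.powersetCard k).filter fun S => f S = i).card ≤
      ((T.powersetCard k).filter fun S => f S = i).card
        + (Ts.powersetCard k \ T.powersetCard k).card := by
    refine le_trans (card_le_card ?_) (card_union_le _ _)
    intro S hS
    simp only [mem_filter, mem_union, mem_sdiff] at hS ⊢
    tauto
  have hsd := card_sdiff_add_card_eq_card hps
  rw [card_powersetCard, card_powersetCard, hT] at hsd
  have hmono : Ts.card.choose k ≤ (n + r).choose k := Nat.choose_le_choose k hcard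
  have h2 := lt_of_le_of_lt (sub_le_sub h1 hpy) (by linarith :
    pe' - py' < 1 - ((n + r).choose k : ℝ) / (n.choose k : ℝ))
  rw [← sub_div, one_sub_div hc.ne', div_lt_div_iff_of_pos_right hc] at h2
  rw [div_lt_div_iff_of_pos_right hc']
  have a1 : (_ : ℝ) ≤ _ := Nat.cast_le.mpr hy
  have a2 : (_ : ℝ) ≤ _ := Nat.cast_le.mpr hi1
  have a3 : ((_ : ℕ) : ℝ) = _ := congrArg Nat.cast hsd
  have a4 : (_ : ℝ) ≤ _ := Nat.cast_le.mpr hmono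
  push_cast at a2 a3
  linarith
end

section
/- Let P be a type, L a finite nonempty set of labels, f : Finset P → L a classifier, T a finite subset of P with |T| = n, k a positive integer, and r a nonnegative integer with k ≤ n − r. Suppose p_y′ and p_e′ are real numbers that are integer multiples of 1/C(n,k) such that p_y′ ≤ Pr(f(S_k(T)) = y) and Pr(f(S_k(T)) = i) ≤ p_e′ for every label i ≠ y, where y ∈ L. If 1 − C(n−r, k)/C(n,k) − p_y′ + p_e′ < 0, then for every finite subset T* of P with T* ⊆ T and |T*| ≥ n − r (i.e., T* is obtained from T by deleting at most r points) and every label i ≠ y we have Pr(f(S_k(T*)) = y) > Pr(f(S_k(T*)) = i). -/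
open Finset

theorem certified_robustness_point_deletion
    {P L : Type*} [Fintype L] [Nonempty L] [DecidableEq P]
    (f : Finset P → L) (T : Finset P) (n k r : ℕ)
    (hT : T.card = n) (hk : 0 < k) (hkr : k ≤ n - r)
    (y : L) (py' pe' : ℝ)
    (hpy_mult : ∃ a : ℤ, py' = (a : ℝ) / (n.choose k : ℝ))
    (hpe_mult : ∃ a : ℤ, pe' = (a : ℝ) / (n.choose k : ℝ))
    (hpy : py' ≤ labelProb f T k y)
    (hpe : ∀ i : L, i ≠ y → labelProb f T k i ≤ pe')
    (hcond : 1 - ((n - r).choose k : ℝ) / (n.choose k : ℝ) - py' + pe' < 0) :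
    ∀ Ts : Finset P, Ts ⊆ T → n - r ≤ Ts.card →
      ∀ i : L, i ≠ y → labelProb f Ts k i < labelProb f Ts k y := by
  classical
  intro Ts hTs hm i hi
  have hsub : Ts.powersetCard k ⊆ T.powersetCard k := powersetCard_mono hTs
  have h1 : ((Ts.powersetCard k).filter fun S => f S = i).card ≤
      ((T.powersetCard k).filter fun S => f S = i).card :=
    card_le_card (filter_subset_filter _ hsub)
  have h2 : ((T.powersetCard k).filter fun S => f S = y).card ≤
      ((Ts.powersetCard k).filter fun S => f S = y).card +
        (T.powersetCard k \ Ts.powersetCard k).card := by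
    refine le_trans (card_le_card ?_) (card_union_le _ _)
    intro S hS
    rw [mem_filter] at hS
    by_cases h : S ∈ Ts.powersetCard k
    · exact mem_union_left _ (mem_filter.mpr ⟨h, hS.2⟩)
    · exact mem_union_right _ (mem_sdiff.mpr ⟨hS.1, h⟩)
  have h3 := card_sdiff_add_card_eq_card hsub
  rw [card_powersetCard, card_powersetCard, hT] at h3
  have h4 : (n - r).choose k ≤ Ts.card.choose k := Nat.choose_le_choose k hm
  have hn : (0 : ℝ) < (n.choose k : ℝ) := by
    exact_mod_cast Nat.choose_pos (by omega)
  have hms : (0 : ℝ) < (Ts.card.choose k : ℝ) := by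
    exact_mod_cast Nat.choose_pos (by omega)
  have hpi := hpe i hi
  unfold labelProb at hpy hpi ⊢
  rw [hT] at hpy hpi
  refine div_lt_div_of_pos_right ?_ hms
  have h5 : (1 : ℝ) - ((n - r).choose k : ℝ) / (n.choose k : ℝ)
      - (((T.powersetCard k).filter fun S => f S = y).card : ℝ) / (n.choose k : ℝ)
      + (((T.powersetCard k).filter fun S => f S = i).card : ℝ) / (n.choose k : ℝ) < 0 := by
    have e1 : ∀ a b c d e : ℝ, 1 - e - a + b < 0 → a ≤ c → d ≤ b → 1 - e - c + d < 0 := by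
      intros; linarith
    refine e1 _ _ _ _ _ hcond ?_ ?_
    · convert hpy
    · convert hpi
  have h6 := mul_neg_of_pos_of_neg hn h5
  have h7 : (n.choose k : ℝ) + (((T.powersetCard k).filter fun S => f S = i).card : ℝ) <
      ((n - r).choose k : ℝ) + (((T.powersetCard k).filter fun S => f S = y).card : ℝ) := by
    field_simp at h6
    linarith
  have h8 : n.choose k + ((T.powersetCard k).filter fun S => f S = i).card <
      (n - r).choose k + ((T.powersetCard k).filter fun S => f S = y).card := by
    exact_mod_cast h7
  have h9 : ((Ts.powersetCard k).filter fun S => f S = i).card <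
      ((Ts.powersetCard k).filter fun S => f S = y).card := by omega
  have h10 : (((Ts.powersetCard k).filter fun S => f S = i).card : ℝ) <
      (((Ts.powersetCard k).filter fun S => f S = y).card : ℝ) := by exact_mod_cast h9
  convert h10
end

section
/- (Lower bound on the perturbed label probability.) Let P be a type, L a finite nonempty set of labels, f : Finset P → L a classifier, and T, T* finite subsets of P with |T| = n, |T*| = t, and |T ∩ T*| = s. Let k be a positive integer with k ≤ n and k ≤ t, and let y ∈ L. Suppose p′ is a real number that is an integer multiple of 1/C(n,k) satisfying p′ ≥ 1 − C(s,k)/C(n,k) and p′ ≤ Pr(f(S_k(T)) = y). Then Pr(f(S_k(T*)) = y) ≥ (C(n,k)/C(t,k)) · (p′ − 1 + C(s,k)/C(n,k)). -/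
open Finset

theorem lower_bound_perturbed_label_probability
    {P L : Type*} [Fintype L] [Nonempty L] [DecidableEq P]
    (f : Finset P → L) (T Ts : Finset P) (n t s k : ℕ)
    (hT : T.card = n) (hTs : Ts.card = t) (hs : (T ∩ Ts).card = s)
    (hk : 0 < k) (hkn : k ≤ n) (hkt : k ≤ t)
    (y : L) (p' : ℝ)
    (hmult : ∃ a : ℤ, p' = (a : ℝ) / (n.choose k : ℝ))
    (hlb : 1 - (s.choose k : ℝ) / (n.choose k : ℝ) ≤ p')
    (hub : p' ≤ labelProb f T k y) :
    ((n.choose k : ℝ) / (t.choose k : ℝ)) * (p' - 1 + (s.choose k : ℝ) / (n.choose k : ℝ))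
      ≤ labelProb f Ts k y := by
  classical
  unfold labelProb at *
  rw [hT] at hub
  rw [hTs]
  have hn0 : (0 : ℝ) < (n.choose k : ℝ) := by exact_mod_cast Nat.choose_pos hkn
  have ht0 : (0 : ℝ) < (t.choose k : ℝ) := by exact_mod_cast Nat.choose_pos hkt
  rw [le_div_iff₀ hn0] at hub
  rw [le_div_iff₀ ht0]
  have key : ((T.powersetCard k).filter fun S => f S = y).card + s.choose k
      ≤ n.choose k + ((Ts.powersetCard k).filter fun S => f S = y).card := by
    rw [← hs, ← hT, ← Finset.card_powersetCard, ← Finset.card_powersetCard,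
      ← Finset.card_union_add_card_inter]
    apply Nat.add_le_add
    · apply Finset.card_le_card
      apply Finset.union_subset (Finset.filter_subset _ _)
      exact Finset.powersetCard_mono Finset.inter_subset_left
    · apply Finset.card_le_card
      intro S hS
      simp only [Finset.mem_inter, Finset.mem_filter, Finset.mem_powersetCard] at hS ⊢
      exact ⟨⟨hS.2.1.trans Finset.inter_subset_right, hS.2.2⟩, hS.1.2⟩
  have key' := (Nat.cast_le (α := ℝ)).2 key
  push_cast at key'
  have e : (n.choose k : ℝ) / (t.choose k : ℝ) * (p' - 1 + (s.choose k : ℝ) / (n.choose k : ℝ))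
      * (t.choose k : ℝ) = p' * n.choose k - n.choose k + s.choose k := by
    field_simp
  rw [e]
  convert (show p' * (n.choose k : ℝ) - n.choose k + s.choose k ≤ _ from ?_) using 1
  have hub' : p' * (n.choose k : ℝ) ≤
      (((T.powersetCard k).filter fun S => f S = y).card : ℝ) := by
    convert hub
  linarith
end

section
/- (Upper bound on the perturbed label probability.) Let P be a type, L a finite nonempty set of labels, f : Finset P → L a classifier, and T, T* finite subsets of P with |T| = n, |T*| = t, and |T ∩ T*| = s. Let k be a positive integer with k ≤ n and k ≤ t, and let i ∈ L. Suppose p′ is a real number that is an integer multiple of 1/C(n,k) satisfying p′ ≤ C(s,k)/C(n,k) and Pr(f(S_k(T)) = i) ≤ p′. Then Pr(f(S_k(T*)) = i) ≤ (C(n,k)/C(t,k)) · p′ + 1 − C(s,k)/C(t,k). -/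
open Finset

theorem upper_bound_perturbed_label_probability
    {P L : Type*} [Fintype L] [Nonempty L] [DecidableEq P]
    (f : Finset P → L) (T Ts : Finset P) (n t s k : ℕ)
    (hT : T.card = n) (hTs : Ts.card = t) (hs : (T ∩ Ts).card = s)
    (hk : 0 < k) (hkn : k ≤ n) (hkt : k ≤ t)
    (i : L) (p' : ℝ)
    (hmult : ∃ a : ℤ, p' = (a : ℝ) / (n.choose k : ℝ))
    (hub : p' ≤ (s.choose k : ℝ) / (n.choose k : ℝ))
    (hlb : labelProb f T k i ≤ p') :
    labelProb f Ts k i ≤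
      ((n.choose k : ℝ) / (t.choose k : ℝ)) * p' + 1
        - (s.choose k : ℝ) / (t.choose k : ℝ) := by
  classical
  subst hT hTs hs
  have hn : (0 : ℝ) < (T.card.choose k : ℝ) := by exact_mod_cast Nat.choose_pos hkn
  have ht : (0 : ℝ) < (Ts.card.choose k : ℝ) := by exact_mod_cast Nat.choose_pos hkt
  unfold labelProb at *
  have hsub : (T ∩ Ts).powersetCard k ⊆ Ts.powersetCard k :=
    Finset.powersetCard_mono Finset.inter_subset_right
  have h1 : ((Ts.powersetCard k).filter fun S => f S = i) ⊆
      ((T.powersetCard k).filter fun S => f S = i) ∪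
        (Ts.powersetCard k \ (T ∩ Ts).powersetCard k) := by
    intro S hS
    simp only [Finset.mem_filter, Finset.mem_union, Finset.mem_sdiff,
      Finset.mem_powersetCard, Finset.subset_inter_iff] at hS ⊢
    tauto
  have h2 := (Finset.card_le_card h1).trans (Finset.card_union_le _ _)
  have h3 := Finset.card_sdiff_add_card_eq_card hsub
  rw [Finset.card_powersetCard, Finset.card_powersetCard] at h3
  have h4 : ((Ts.powersetCard k).filter fun S => f S = i).card + (T ∩ Ts).card.choose k ≤
      ((T.powersetCard k).filter fun S => f S = i).card + Ts.card.choose k := by omega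
  have h5 : (((Ts.powersetCard k).filter fun S => f S = i).card : ℝ)
      + ((T ∩ Ts).card.choose k : ℝ) ≤
      (((T.powersetCard k).filter fun S => f S = i).card : ℝ) + (Ts.card.choose k : ℝ) := by
    exact_mod_cast h4
  rw [div_le_iff₀ hn] at hlb
  rw [div_le_iff₀ ht]
  have h6 : ((T.card.choose k : ℝ) / (Ts.card.choose k : ℝ) * p' + 1
      - ((T ∩ Ts).card.choose k : ℝ) / (Ts.card.choose k : ℝ)) * (Ts.card.choose k : ℝ)
      = (T.card.choose k : ℝ) * p' + (Ts.card.choose k : ℝ)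
        - ((T ∩ Ts).card.choose k : ℝ) := by
    field_simp
  rw [h6]
  have h7 : (((T.powersetCard k).filter fun S => f S = i).card : ℝ)
      ≤ p' * (T.card.choose k : ℝ) := by
    convert hlb
  have h8 : (((Ts.powersetCard k).filter fun S => f S = i).card : ℝ)
      ≤ (T.card.choose k : ℝ) * p' + (Ts.card.choose k : ℝ)
        - ((T ∩ Ts).card.choose k : ℝ) := by linarith
  convert h8
end

section
/- (Monotonicity of the certification condition, justifying binary search.) Let n and k be positive integers with k ≤ n, let δ be a real number, and let r and r′ be nonnegative integers with r′ ≤ r and k ≤ n − r. If for every integer t with n − r ≤ t ≤ n + r it holds that C(t,k)/C(n,k) − 2·C(max(n,t) − r, k)/C(n,k) + δ < 0, then for every integer t′ with n − r′ ≤ t′ ≤ n + r′ it holds that C(t′,k)/C(n,k) − 2·C(max(n,t′) − r′, k)/C(n,k) + δ < 0. -/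
theorem certification_condition_monotone
    (n k : ℕ) (hn : 0 < n) (hk : 0 < k) (hkn : k ≤ n)
    (δ : ℝ) (r r' : ℕ) (hrr : r' ≤ r) (hkr : k ≤ n - r)
    (hcond : ∀ t : ℕ, n - r ≤ t → t ≤ n + r →
      (t.choose k : ℝ) / (n.choose k : ℝ)
        - 2 * (((max n t - r).choose k : ℝ) / (n.choose k : ℝ)) + δ < 0) :
    ∀ t' : ℕ, n - r' ≤ t' → t' ≤ n + r' →
      (t'.choose k : ℝ) / (n.choose k : ℝ)
        - 2 * (((max n t' - r').choose k : ℝ) / (n.choose k : ℝ)) + δ < 0 := by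
  intro t h1 h2
  have h := hcond t (by omega) (by omega)
  have hc : (((max n t - r).choose k : ℕ) : ℝ) ≤ ((max n t - r').choose k : ℕ) := by
    exact_mod_cast Nat.choose_le_choose k (Nat.sub_le_sub_left hrr _)
  have hd := div_le_div_of_nonneg_right hc (Nat.cast_nonneg (α := ℝ) (n.choose k))
  linarith
end
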